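/- Let μ, ν ∈ ℝ and let f : [0,∞) → ℝ be continuously differentiable with f and f' bounded and f(x) → 0 as x → ∞. Define u²(t,x) = ∫₀^∞ f'(y) H(t;x,y) dy for t > 0 and x ≥ 0. Then for every x > 0 the spatial derivative ∂_x u²(t,x) converges to 0 as t ↓ 0, while the one-sided spatial derivative at the boundary satisfies ∂_x u²(t,0) → −f'(0) as t ↓ 0. -/

import Mathlib

open MeasureTheory Set Filter

/-- Standard normal density. -/
noncomputable def phi (x : ℝ) : ℝ := (1 / Real.sqrt (2 * Real.pi)) * Real.exp (-x ^ 2 / 2)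

/-- Standard normal tail function. -/
noncomputable def Psi (x : ℝ) : ℝ := ∫ y in Set.Ioi x, phi y

/-- The kernel `G(t;x,y)` with drift parameter `μ`. -/
noncomputable def Gker (μ t x y : ℝ) : ℝ :=
  (1 / Real.sqrt t) *
      (Real.exp (2 * μ * y) * phi ((x + y + μ * t) / Real.sqrt t) +
        phi ((x - y + μ * t) / Real.sqrt t)) -
    2 * μ * Real.exp (2 * μ * y) * Psi ((x + y + μ * t) / Real.sqrt t)

/-- The kernel `H(t;x,y)` with parameters `μ, ν`. -/
noncomputable def Hker (μ ν t x y : ℝ) : ℝ :=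
  if ν = μ then
    2 * Real.exp (2 * μ * y) *
      ((1 + μ * (x + y + μ * t)) * Psi ((x + y + μ * t) / Real.sqrt t) -
        μ * Real.sqrt t * phi ((x + y + μ * t) / Real.sqrt t))
  else
    Real.exp (2 * μ * y) / (ν - μ) *
      ((2 * ν - μ) * Real.exp (2 * (ν - μ) * (x + y + ν * t)) *
          Psi ((x + y + (2 * ν - μ) * t) / Real.sqrt t) -
        μ * Psi ((x + y + μ * t) / Real.sqrt t))

/-- The density `g(t;b,s)` of `(B_t^{-μ}, S_t^{-μ})`, vanishing off `{b ≤ s, 0 ≤ s}`. -/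
noncomputable def gker (μ t b s : ℝ) : ℝ :=
  if b ≤ s ∧ 0 ≤ s then
    Real.sqrt (2 / Real.pi) * t ^ (-(3 : ℝ) / 2) * (2 * s - b) *
      Real.exp (-(2 * s - b) ^ 2 / (2 * t) - μ * (b + μ * t / 2))
  else 0

/-- Spatial derivative (one-sided at `x = 0`). -/
noncomputable def ux (u : ℝ → ℝ → ℝ) (t x : ℝ) : ℝ :=
  derivWithin (fun z => u t z) (Set.Ici 0) x

/-- Second spatial derivative (one-sided at `x = 0`). -/
noncomputable def uxx (u : ℝ → ℝ → ℝ) (t x : ℝ) : ℝ :=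
  derivWithin (fun z => ux u t z) (Set.Ici 0) x

/-- Time derivative. -/
noncomputable def ut (u : ℝ → ℝ → ℝ) (t x : ℝ) : ℝ :=
  deriv (fun s => u s x) t

/-- `u` is a solution of the Stroock–Williams problem with parameters `μ, ν`
and initial data `f`. -/
def IsSWSolution (μ ν : ℝ) (f : ℝ → ℝ) (u : ℝ → ℝ → ℝ) : Prop :=
  ContDiffOn ℝ (⊤ : ℕ∞) (fun p : ℝ × ℝ => u p.1 p.2) (Set.Ioi 0 ×ˢ Set.Ici 0) ∧
  (∀ T > (0 : ℝ),
    ContinuousOn (fun p : ℝ × ℝ => u p.1 p.2) (Set.Icc 0 T ×ˢ Set.Ici 0) ∧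
    ContinuousOn (fun p : ℝ × ℝ => ux u p.1 p.2) (Set.Icc 0 T ×ˢ Set.Ici 0) ∧
    ∃ C : ℝ, ∀ p ∈ Set.Icc (0 : ℝ) T ×ˢ Set.Ici (0 : ℝ),
      |u p.1 p.2| ≤ C ∧ |ux u p.1 p.2| ≤ C) ∧
  (∀ t > (0 : ℝ), Filter.Tendsto (fun x => u t x) Filter.atTop (nhds 0)) ∧
  (∀ t > (0 : ℝ), ∀ x ≥ (0 : ℝ), ut u t x = μ * ux u t x + (1 / 2) * uxx u t x) ∧
  (∀ x ≥ (0 : ℝ), u 0 x = f x) ∧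
  (∀ t > (0 : ℝ), ut u t 0 = ν * ux u t 0)

/-- `f` is admissible initial data: `C¹` on `[0,∞)` with `f` and `f'` bounded
and `f(x) → 0` as `x → ∞`. -/
def IsInitialData (f : ℝ → ℝ) : Prop :=
  ContDiffOn ℝ 1 f (Set.Ici 0) ∧
  (∃ C : ℝ, ∀ x ∈ Set.Ici (0 : ℝ), |f x| ≤ C ∧ |derivWithin f (Set.Ici 0) x| ≤ C) ∧
  Filter.Tendsto f Filter.atTop (nhds 0)

open scoped Topology

theorem phi_nonneg (x : ℝ) : 0 ≤ phi x := by unfold phi; positivity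

theorem continuous_phi : Continuous phi := by unfold phi; fun_prop

theorem integrable_phi : Integrable phi := by
  have h := (integrable_exp_neg_mul_sq (b := 1 / 2) (by norm_num)).const_mul
    (1 / Real.sqrt (2 * Real.pi))
  refine h.congr (ae_of_all _ fun x => ?_)
  simp only [phi]
  congr 2
  ring

theorem integral_phi_Ioi_zero : ∫ x in Ioi (0 : ℝ), phi x = 1 / 2 := by
  have h : ∀ x, phi x = 1 / Real.sqrt (2 * Real.pi) * Real.exp (-(1 / 2) * x ^ 2) := by
    intro x
    simp only [phi]
    congr 2
    ring
  simp_rw [h]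
  rw [integral_const_mul, integral_gaussian_Ioi,
    show Real.pi / (1 / 2) = 2 * Real.pi by ring]
  have : Real.sqrt (2 * Real.pi) ≠ 0 := by positivity
  field_simp

/-- Exponential (Chernoff) bound for the normal density, valid for every slope `L`. -/
theorem phi_le_exp (L a : ℝ) : phi a ≤ Real.exp (L ^ 2 / 2 - L * a) := by
  have hpi : 1 ≤ Real.sqrt (2 * Real.pi) := by
    rw [Real.one_le_sqrt]
    linarith [Real.pi_gt_three]
  have h1 : 1 / Real.sqrt (2 * Real.pi) ≤ 1 := by
    rw [div_le_one (by positivity)]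
    exact hpi
  calc phi a ≤ 1 * Real.exp (-a ^ 2 / 2) := by
        unfold phi
        gcongr
    _ ≤ _ := by
        rw [one_mul]
        exact Real.exp_le_exp.mpr (by nlinarith [sq_nonneg (a - L)])

theorem Psi_nonneg (a : ℝ) : 0 ≤ Psi a := integral_nonneg fun x => phi_nonneg x

theorem Psi_le_exp {L : ℝ} (hL : 0 < L) (a : ℝ) :
    Psi a ≤ Real.exp (L ^ 2 / 2 - L * a) / L := by
  have hint : IntegrableOn (fun y => Real.exp (L ^ 2 / 2) * Real.exp (-L * y)) (Ioi a) :=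
    (integrableOn_exp_mul_Ioi (neg_lt_zero.mpr hL) a).const_mul _
  calc Psi a ≤ ∫ y in Ioi a, Real.exp (L ^ 2 / 2) * Real.exp (-L * y) := by
        refine integral_mono integrable_phi.integrableOn hint fun y => ?_
        simp only
        rw [← Real.exp_add, neg_mul, ← sub_eq_add_neg]
        exact phi_le_exp L y
    _ = _ := by
        rw [integral_const_mul, integral_exp_mul_Ioi (neg_lt_zero.mpr hL), sub_eq_add_neg,
          Real.exp_add, neg_div_neg_eq, neg_mul]
        ring

theorem hasDerivAt_Psi (x : ℝ) : HasDerivAt Psi (-phi x) x := by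
  have h : Psi = fun x => Psi 0 - ∫ y in (0 : ℝ)..x, phi y := by
    funext x
    have := intervalIntegral.integral_interval_add_Ioi
      (integrable_phi.integrableOn (s := Ioi (0 : ℝ))) (integrable_phi.integrableOn (s := Ioi x))
    unfold Psi
    linarith
  rw [h]
  exact (intervalIntegral.integral_hasDerivAt_right (continuous_phi.intervalIntegrable _ _)
    (continuous_phi.stronglyMeasurableAtFilter _ _) continuous_phi.continuousAt).const_sub _

theorem hasDerivAt_phi (x : ℝ) : HasDerivAt phi (-x * phi x) x := by
  have h : HasDerivAt (fun x : ℝ => -x ^ 2 / 2) (-x) x := by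
    refine ((hasDerivAt_pow 2 x).neg.div_const 2).congr_deriv ?_
    norm_num
    ring
  refine (h.exp.const_mul (1 / Real.sqrt (2 * Real.pi))).congr_deriv ?_
  simp only [phi]
  ring

theorem continuous_Psi : Continuous Psi :=
  continuous_iff_continuousAt.mpr fun x => (hasDerivAt_Psi x).continuousAt

theorem tendsto_exp_const_sub_atTop (b : ℝ) :
    Tendsto (fun a : ℝ => Real.exp (b - 1 * a)) atTop (𝓝 0) := by
  simp only [one_mul, sub_eq_add_neg]
  exact Real.tendsto_exp_atBot.comp (tendsto_atBot_add_const_left _ _ tendsto_neg_atTop_atBot)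

theorem tendsto_Psi_atTop : Tendsto Psi atTop (𝓝 0) :=
  squeeze_zero Psi_nonneg (fun a => Psi_le_exp one_pos a)
    (by simpa only [div_one] using tendsto_exp_const_sub_atTop _)

theorem tendsto_phi_atTop : Tendsto phi atTop (𝓝 0) :=
  squeeze_zero phi_nonneg (fun a => phi_le_exp 1 a) (tendsto_exp_const_sub_atTop _)

/-- `g` is dominated by a multiple of `exp (-M z)` on all of `ℝ`, for every large rate `M`. -/
def SuperexpDecay (g : ℝ → ℝ) : Prop :=
  ∀ᶠ M : ℝ in atTop, ∃ C : ℝ, ∀ z, |g z| ≤ C * Real.exp (-M * z)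

namespace SuperexpDecay

variable {g h : ℝ → ℝ}

theorem const_mul (hg : SuperexpDecay g) (c : ℝ) : SuperexpDecay fun z => c * g z := by
  filter_upwards [hg] with M ⟨C, hC⟩
  refine ⟨|c| * C, fun z => ?_⟩
  rw [abs_mul, mul_assoc]
  exact mul_le_mul_of_nonneg_left (hC z) (abs_nonneg c)

theorem add (hg : SuperexpDecay g) (hh : SuperexpDecay h) :
    SuperexpDecay fun z => g z + h z := by
  filter_upwards [hg, hh] with M ⟨C, hC⟩ ⟨D, hD⟩
  refine ⟨C + D, fun z => (abs_add_le _ _).trans ?_⟩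
  rw [add_mul]
  exact add_le_add (hC z) (hD z)

theorem sub (hg : SuperexpDecay g) (hh : SuperexpDecay h) :
    SuperexpDecay fun z => g z - h z := by
  simpa [sub_eq_add_neg] using hg.add (hh.const_mul (-1))

theorem exp_mul (hg : SuperexpDecay g) (c : ℝ) :
    SuperexpDecay fun z => Real.exp (c * z) * g z := by
  filter_upwards [(tendsto_atTop_add_const_right atTop c tendsto_id).eventually hg] with M ⟨C, hC⟩
  refine ⟨C, fun z => ?_⟩
  rw [abs_mul, Real.abs_exp]
  calc Real.exp (c * z) * |g z| ≤ Real.exp (c * z) * (C * Real.exp (-(id M + c) * z)) := by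
        gcongr
        exact hC z
    _ = C * Real.exp (-M * z) := by
        rw [mul_left_comm, ← Real.exp_add]
        congr 2
        simp only [id]
        ring

theorem id_mul (hg : SuperexpDecay g) : SuperexpDecay fun z => z * g z := by
  filter_upwards [hg.exp_mul 1, hg.exp_mul (-1)] with M ⟨C, hC⟩ ⟨D, hD⟩
  refine ⟨C + D, fun z => ?_⟩
  have hz : |z| ≤ Real.exp (1 * z) + Real.exp (-1 * z) := by
    rw [abs_le]
    constructor <;>
      linarith [Real.add_one_le_exp (1 * z), Real.add_one_le_exp (-1 * z),
        Real.exp_pos (1 * z), Real.exp_pos (-1 * z)]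
  rw [abs_mul]
  calc |z| * |g z| ≤ (Real.exp (1 * z) + Real.exp (-1 * z)) * |g z| := by gcongr
    _ = |Real.exp (1 * z) * g z| + |Real.exp (-1 * z) * g z| := by
        rw [abs_mul, abs_mul, Real.abs_exp, Real.abs_exp, add_mul]
    _ ≤ _ := by
        rw [add_mul]
        exact add_le_add (hC z) (hD z)

theorem phi_affine {s : ℝ} (hs : 0 < s) (d : ℝ) : SuperexpDecay fun z => phi ((z + d) / s) := by
  refine Eventually.of_forall fun M => ⟨Real.exp ((M * s) ^ 2 / 2 - M * d), fun z => ?_⟩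
  rw [abs_of_nonneg (phi_nonneg _), ← Real.exp_add]
  convert phi_le_exp (M * s) ((z + d) / s) using 2
  field_simp
  ring

theorem Psi_affine {s : ℝ} (hs : 0 < s) (d : ℝ) : SuperexpDecay fun z => Psi ((z + d) / s) := by
  filter_upwards [eventually_gt_atTop 0] with M hM
  refine ⟨Real.exp ((M * s) ^ 2 / 2 - M * d) / (M * s), fun z => ?_⟩
  rw [abs_of_nonneg (Psi_nonneg _), div_mul_eq_mul_div, ← Real.exp_add]
  convert Psi_le_exp (mul_pos hM hs) ((z + d) / s) using 3
  field_simp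
  ring

end SuperexpDecay

theorem abs_weight_mul_exp_mul_le {w g : ℝ → ℝ} {B c x M E : ℝ} (hM : 0 ≤ M)
    (hB : ∀ y ∈ Ioi (0 : ℝ), |w y| ≤ B) (hE : ∀ z, |g z| ≤ E * Real.exp (-M * z))
    {x' y : ℝ} (hx : x ≤ x') (hy : y ∈ Ioi (0 : ℝ)) :
    ‖w y * (Real.exp (c * y) * g (x' + y))‖ ≤
      B * E * Real.exp (-M * x) * Real.exp ((c - M) * y) := by
  have hB0 : 0 ≤ B := (abs_nonneg _).trans (hB y hy)
  have hE0 : 0 ≤ E := by simpa using (abs_nonneg _).trans (hE 0)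
  rw [Real.norm_eq_abs, abs_mul, abs_mul, Real.abs_exp]
  calc |w y| * (Real.exp (c * y) * |g (x' + y)|)
      ≤ B * (Real.exp (c * y) * (E * Real.exp (-M * (x' + y)))) := by
        gcongr
        · exact hB y hy
        · exact hE _
    _ ≤ B * (Real.exp (c * y) * (E * Real.exp (-M * (x + y)))) := by
        gcongr B * (Real.exp (c * y) * (E * Real.exp ?_))
        nlinarith
    _ = _ := by
        rw [show -M * (x + y) = -M * x + -M * y by ring,
          show (c - M) * y = c * y + -M * y by ring, Real.exp_add, Real.exp_add]
        ring

theorem aestronglyMeasurable_weight_mul {w g : ℝ → ℝ} (c x : ℝ)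
    (hw : AEStronglyMeasurable w (volume.restrict (Ioi 0))) (hg : Continuous g) :
    AEStronglyMeasurable (fun y => w y * (Real.exp (c * y) * g (x + y)))
      (volume.restrict (Ioi 0)) :=
  hw.mul (by fun_prop : Continuous _).aestronglyMeasurable

theorem integrableOn_weight_mul {w g : ℝ → ℝ} {B : ℝ} (c x : ℝ)
    (hw : AEStronglyMeasurable w (volume.restrict (Ioi 0)))
    (hB : ∀ y ∈ Ioi (0 : ℝ), |w y| ≤ B) (hg : SuperexpDecay g) (hgc : Continuous g) :
    IntegrableOn (fun y => w y * (Real.exp (c * y) * g (x + y))) (Ioi 0) := by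
  obtain ⟨M, ⟨E, hE⟩, hMc, hM0⟩ := (hg.and
    ((eventually_gt_atTop c).and (eventually_ge_atTop 0))).exists
  exact ((integrableOn_exp_mul_Ioi (sub_neg.mpr hMc) 0).const_mul _).mono'
    (aestronglyMeasurable_weight_mul c x hw hgc)
    ((ae_restrict_mem measurableSet_Ioi).mono fun y hy =>
      abs_weight_mul_exp_mul_le hM0 hB hE le_rfl hy)

/-- A weight that is measurable and bounded on `(0, ∞)`, times an exponential, times a
superexponentially decaying function, is differentiated under the integral sign. -/
theorem hasDerivAt_integral_weight_mul {w h k : ℝ → ℝ} {B : ℝ} (c x : ℝ)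
    (hw : AEStronglyMeasurable w (volume.restrict (Ioi 0)))
    (hB : ∀ y ∈ Ioi (0 : ℝ), |w y| ≤ B)
    (hh : SuperexpDecay h) (hk : SuperexpDecay k) (hkc : Continuous k)
    (hd : ∀ z, HasDerivAt h (k z) z) :
    HasDerivAt (fun x => ∫ y in Ioi (0 : ℝ), w y * (Real.exp (c * y) * h (x + y)))
      (∫ y in Ioi (0 : ℝ), w y * (Real.exp (c * y) * k (x + y))) x := by
  have hhc : Continuous h := continuous_iff_continuousAt.mpr fun z => (hd z).continuousAt
  obtain ⟨M, ⟨D, hD⟩, hMc, hM0⟩ := (hk.and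
    ((eventually_gt_atTop c).and (eventually_ge_atTop 0))).exists
  refine (hasDerivAt_integral_of_dominated_loc_of_deriv_le
    (F := fun x y => w y * (Real.exp (c * y) * h (x + y)))
    (F' := fun x y => w y * (Real.exp (c * y) * k (x + y))) (Ioi_mem_nhds (sub_one_lt x))
    (Eventually.of_forall fun x => aestronglyMeasurable_weight_mul c x hw hhc)
    (integrableOn_weight_mul c x hw hB hh hhc) (aestronglyMeasurable_weight_mul c x hw hkc)
    ((ae_restrict_mem measurableSet_Ioi).mono fun y hy x' hx' =>
      abs_weight_mul_exp_mul_le hM0 hB hD (le_of_lt hx') hy)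
    ((integrableOn_exp_mul_Ioi (sub_neg.mpr hMc) 0).const_mul _)
    (ae_of_all _ fun y x' _ => ?_)).2
  exact (((hd (x' + y)).comp_add_const x' y).const_mul _).const_mul _

/-- The factor of `Hker` depending on `x` and `y` only through `z = x + y`. -/
noncomputable def Hprofile (μ ν t z : ℝ) : ℝ :=
  if ν = μ then
    2 * ((1 + μ * (z + μ * t)) * Psi ((z + μ * t) / Real.sqrt t) -
      μ * Real.sqrt t * phi ((z + μ * t) / Real.sqrt t))
  else
    1 / (ν - μ) * ((2 * ν - μ) * Real.exp (2 * (ν - μ) * (z + ν * t)) *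
      Psi ((z + (2 * ν - μ) * t) / Real.sqrt t) - μ * Psi ((z + μ * t) / Real.sqrt t))

/-- The derivative of `Hprofile` in `z`. -/
noncomputable def HprofileDeriv (μ ν t z : ℝ) : ℝ :=
  2 * (2 * ν - μ) * (Real.exp (2 * (ν - μ) * (z + ν * t)) *
      Psi ((z + (2 * ν - μ) * t) / Real.sqrt t)) -
    2 / Real.sqrt t * phi ((z + μ * t) / Real.sqrt t)

theorem Hker_eq_exp_mul_Hprofile (μ ν t x y : ℝ) :
    Hker μ ν t x y = Real.exp (2 * μ * y) * Hprofile μ ν t (x + y) := by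
  unfold Hker Hprofile
  split_ifs <;> ring

theorem exp_mul_phi_shift (μ ν z : ℝ) {t : ℝ} (ht : 0 < t) :
    Real.exp (2 * (ν - μ) * (z + ν * t)) * phi ((z + (2 * ν - μ) * t) / Real.sqrt t) =
      phi ((z + μ * t) / Real.sqrt t) := by
  unfold phi
  rw [mul_left_comm, ← Real.exp_add, div_pow, div_pow, Real.sq_sqrt ht.le]
  congr 2
  field_simp
  ring

theorem hasDerivAt_Hprofile (μ ν z : ℝ) {t : ℝ} (ht : 0 < t) :
    HasDerivAt (Hprofile μ ν t) (HprofileDeriv μ ν t z) z := by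
  have hs : Real.sqrt t ≠ 0 := (Real.sqrt_pos.mpr ht).ne'
  have hlin : ∀ d, HasDerivAt (fun z => (z + d) / Real.sqrt t) (1 / Real.sqrt t) z :=
    fun d => ((hasDerivAt_id z).add_const d).div_const _
  have hPsi : ∀ d, HasDerivAt (fun z => Psi ((z + d) / Real.sqrt t))
      (-phi ((z + d) / Real.sqrt t) * (1 / Real.sqrt t)) z :=
    fun d => (hasDerivAt_Psi _).comp z (hlin d)
  by_cases h : ν = μ
  · subst h
    have hphi : HasDerivAt (fun z => phi ((z + ν * t) / Real.sqrt t))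
        (-((z + ν * t) / Real.sqrt t) * phi ((z + ν * t) / Real.sqrt t) * (1 / Real.sqrt t)) z :=
      (hasDerivAt_phi _).comp z (hlin _)
    have hfun : Hprofile ν ν t = fun z => 2 * ((1 + ν * (z + ν * t)) *
        Psi ((z + ν * t) / Real.sqrt t) - ν * Real.sqrt t * phi ((z + ν * t) / Real.sqrt t)) := by
      funext z
      simp [Hprofile]
    rw [hfun]
    have haff : HasDerivAt (fun z => 1 + ν * (z + ν * t)) (ν * 1) z :=
      (((hasDerivAt_id z).add_const _).const_mul ν).const_add 1
    refine (((haff.mul (hPsi _)).sub (hphi.const_mul (ν * Real.sqrt t))).const_mul 2).congr_deriv ?_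
    simp only [HprofileDeriv, sub_self, mul_zero, zero_mul, Real.exp_zero, one_mul,
      show 2 * ν - ν = ν by ring]
    field_simp
    ring
  · have hne : ν - μ ≠ 0 := sub_ne_zero.mpr h
    have hfun : Hprofile μ ν t = fun z => 1 / (ν - μ) *
        ((2 * ν - μ) * Real.exp (2 * (ν - μ) * (z + ν * t)) *
          Psi ((z + (2 * ν - μ) * t) / Real.sqrt t) - μ * Psi ((z + μ * t) / Real.sqrt t)) := by
      funext z
      simp [Hprofile, h]
    rw [hfun]
    have hexp : HasDerivAt (fun z => Real.exp (2 * (ν - μ) * (z + ν * t)))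
        (Real.exp (2 * (ν - μ) * (z + ν * t)) * (2 * (ν - μ) * 1)) z :=
      (((hasDerivAt_id z).add_const _).const_mul _).exp
    refine ((((hexp.const_mul (2 * ν - μ)).mul (hPsi _)).sub
      ((hPsi _).const_mul μ)).const_mul (1 / (ν - μ))).congr_deriv ?_
    simp only [HprofileDeriv]
    rw [← exp_mul_phi_shift μ ν z ht]
    field_simp
    ring

theorem continuous_HprofileDeriv (μ ν t : ℝ) : Continuous (HprofileDeriv μ ν t) := by
  have h1 := continuous_Psi
  have h2 := continuous_phi
  unfold HprofileDeriv
  fun_prop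

theorem superexpDecay_exp_mul_Psi (c d d' : ℝ) {s : ℝ} (hs : 0 < s) :
    SuperexpDecay fun z => Real.exp (c * (z + d)) * Psi ((z + d') / s) := by
  convert ((SuperexpDecay.Psi_affine hs d').exp_mul c).const_mul (Real.exp (c * d)) using 2 with z
  rw [mul_add, Real.exp_add]
  ring

theorem superexpDecay_Hprofile (μ ν : ℝ) {t : ℝ} (ht : 0 < t) :
    SuperexpDecay (Hprofile μ ν t) := by
  have hs := Real.sqrt_pos.mpr ht
  by_cases h : ν = μ
  · have hP := SuperexpDecay.Psi_affine hs (μ * t)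
    convert (((hP.const_mul (1 + μ * (μ * t))).add (hP.id_mul.const_mul μ)).sub
      ((SuperexpDecay.phi_affine hs (μ * t)).const_mul (μ * Real.sqrt t))).const_mul 2 using 2 with z
    simp only [Hprofile, h, if_true]
    ring
  · convert (((superexpDecay_exp_mul_Psi (2 * (ν - μ)) (ν * t) ((2 * ν - μ) * t) hs).const_mul
      (2 * ν - μ)).sub ((SuperexpDecay.Psi_affine hs (μ * t)).const_mul μ)).const_mul
        (1 / (ν - μ)) using 2 with z
    simp only [Hprofile, h, if_false]
    ring

theorem superexpDecay_HprofileDeriv (μ ν : ℝ) {t : ℝ} (ht : 0 < t) :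
    SuperexpDecay (HprofileDeriv μ ν t) :=
  have hs := Real.sqrt_pos.mpr ht
  ((superexpDecay_exp_mul_Psi _ _ _ hs).const_mul _).sub
    ((SuperexpDecay.phi_affine hs _).const_mul _)

theorem tendsto_sqrt_nhdsGT_zero : Tendsto Real.sqrt (𝓝[>] 0) (𝓝[>] 0) :=
  tendsto_nhdsWithin_of_tendsto_nhds_of_eventually_within _
    ((Real.continuous_sqrt.tendsto' 0 0 Real.sqrt_zero).mono_left nhdsWithin_le_nhds)
    (eventually_mem_nhdsWithin.mono fun _ ht => Real.sqrt_pos.mpr ht)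

/-- `(z + d t) / √t → ∞` as `t ↓ 0`, for `z > 0`, written in terms of `s = √t`. -/
theorem tendsto_add_mul_sq_div_atTop {z : ℝ} (hz : 0 < z) (d : ℝ) :
    Tendsto (fun s : ℝ => (z + d * s ^ 2) / s) (𝓝[>] 0) atTop := by
  have h1 : Tendsto (fun s : ℝ => z + d * s ^ 2) (𝓝[>] 0) (𝓝 z) := by
    refine (Continuous.tendsto' ?_ 0 z (by simp)).mono_left nhdsWithin_le_nhds
    fun_prop
  simpa only [div_eq_mul_inv] using h1.pos_mul_atTop hz tendsto_inv_nhdsGT_zero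

theorem tendsto_integral_weight_mul_exp_mul_Psi {w : ℝ → ℝ} {B x : ℝ} (b c d κ : ℝ)
    (hw : AEStronglyMeasurable w (volume.restrict (Ioi 0)))
    (hB : ∀ y ∈ Ioi (0 : ℝ), |w y| ≤ B) (hx : 0 ≤ x) :
    Tendsto (fun t => ∫ y in Ioi (0 : ℝ), w y * (Real.exp (c * y) *
        (Real.exp (b * (x + y + d * t)) * Psi ((x + y + κ * t) / Real.sqrt t))))
      (𝓝[>] 0) (𝓝 0) := by
  have hΨ := continuous_Psi
  set L : ℝ := |c| + |b| + 1 with hL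
  have hL1 : 1 ≤ L := by linarith [abs_nonneg b, abs_nonneg c]
  have key := tendsto_integral_filter_of_dominated_convergence
    (μ := volume.restrict (Ioi (0 : ℝ))) (l := 𝓝[>] (0 : ℝ))
    (F := fun t y => w y * (Real.exp (c * y) *
        (Real.exp (b * (x + y + d * t)) * Psi ((x + y + κ * t) / Real.sqrt t))))
    (f := fun _ => (0 : ℝ))
    (fun y => B * Real.exp (|b| * (x + |d|) + L ^ 2 / 2 + L * |κ|) * Real.exp (-1 * y))
    (Eventually.of_forall fun t =>
      hw.mul (by fun_prop : Continuous _).aestronglyMeasurable) ?_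
    ((integrableOn_exp_mul_Ioi (by norm_num) 0).const_mul _) ?_
  · simpa using key
  · filter_upwards [Ioo_mem_nhdsGT one_pos] with t ⟨ht0, ht1⟩
    filter_upwards [ae_restrict_mem measurableSet_Ioi] with y hy
    have hy0 : 0 < y := hy
    have hs0 : 0 < Real.sqrt t := Real.sqrt_pos.mpr ht0
    have hs1 : Real.sqrt t ≤ 1 := Real.sqrt_le_one.mpr ht1.le
    have hB0 : 0 ≤ B := (abs_nonneg _).trans (hB y hy)
    have harg : x + y - |κ| ≤ (x + y + κ * t) / Real.sqrt t := by
      rw [le_div_iff₀ hs0]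
      have hκ := neg_abs_le κ
      have hsq : Real.sqrt t * Real.sqrt t = t := Real.mul_self_sqrt ht0.le
      nlinarith [abs_nonneg κ, mul_nonneg (add_nonneg hx hy0.le) (sub_nonneg.mpr hs1),
        mul_nonneg (abs_nonneg κ) (mul_nonneg hs0.le (sub_nonneg.mpr hs1))]
    have hΨle : Psi ((x + y + κ * t) / Real.sqrt t) ≤
        Real.exp (L ^ 2 / 2 - L * (x + y - |κ|)) := by
      refine (Psi_le_exp (by linarith) _).trans ((div_le_self (Real.exp_pos _).le hL1).trans ?_)
      gcongr
    have hbe : b * (x + y + d * t) ≤ |b| * (x + y + |d|) := by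
      have hdt : |d * t| ≤ |d| := by
        rw [abs_mul, abs_of_pos ht0]
        exact mul_le_of_le_one_right (abs_nonneg d) ht1.le
      calc b * (x + y + d * t) ≤ |b| * |x + y + d * t| := by
            rw [← abs_mul]
            exact le_abs_self _
        _ ≤ |b| * (x + y + |d|) := by
            gcongr
            refine (abs_add_le _ _).trans ?_
            rw [abs_of_nonneg (add_nonneg hx hy0.le)]
            gcongr
    have hce : c * y ≤ |c| * y := by
      gcongr
      exact le_abs_self c
    rw [Real.norm_eq_abs, abs_mul, abs_mul, abs_mul, Real.abs_exp, Real.abs_exp,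
      abs_of_nonneg (Psi_nonneg _)]
    calc |w y| * (Real.exp (c * y) * (Real.exp (b * (x + y + d * t)) *
          Psi ((x + y + κ * t) / Real.sqrt t)))
        ≤ B * (Real.exp (|c| * y) * (Real.exp (|b| * (x + y + |d|)) *
            Real.exp (L ^ 2 / 2 - L * (x + y - |κ|)))) := by
          have := Psi_nonneg ((x + y + κ * t) / Real.sqrt t)
          gcongr
          exact hB y hy
      _ ≤ _ := by
          rw [mul_assoc B, ← Real.exp_add, ← Real.exp_add, ← Real.exp_add]
          refine mul_le_mul_of_nonneg_left (Real.exp_le_exp.mpr ?_) hB0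
          nlinarith [mul_nonneg (zero_le_one.trans hL1) hx]
  · filter_upwards [ae_restrict_mem measurableSet_Ioi] with y hy
    have hz : 0 < x + y := add_pos_of_nonneg_of_pos hx hy
    have h1 : Tendsto (fun t => Psi ((x + y + κ * t) / Real.sqrt t)) (𝓝[>] 0) (𝓝 0) := by
      refine (tendsto_Psi_atTop.comp ((tendsto_add_mul_sq_div_atTop hz κ).comp
        tendsto_sqrt_nhdsGT_zero)).congr' ?_
      filter_upwards [self_mem_nhdsWithin] with t ht
      simp [Real.sq_sqrt (le_of_lt (mem_Ioi.mp ht))]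
    have h2 : Tendsto (fun t => Real.exp (b * (x + y + d * t))) (𝓝[>] 0)
        (𝓝 (Real.exp (b * (x + y + d * 0)))) :=
      ((by fun_prop : Continuous fun t => Real.exp (b * (x + y + d * t))).tendsto 0).mono_left
        nhdsWithin_le_nhds
    simpa using ((h2.mul h1).const_mul (Real.exp (c * y))).const_mul (w y)

/-- Concentration at `y = 0` of the rescaled normal density, in terms of `s = √t`. -/
theorem tendsto_integral_weight_mul_exp_mul_phi {w p : ℝ → ℝ} {B x : ℝ} (c d : ℝ)
    (hw : ContinuousOn w (Ici 0)) (hB : ∀ y ∈ Ioi (0 : ℝ), |w y| ≤ B) (hx : 0 ≤ x)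
    (hp : ∀ u ∈ Ioi (0 : ℝ),
      Tendsto (fun s => phi ((x + s * u + d * s ^ 2) / s)) (𝓝[>] 0) (𝓝 (p u))) :
    Tendsto (fun s => ∫ y in Ioi (0 : ℝ), w y * (Real.exp (c * y) *
        (1 / s * phi ((x + y + d * s ^ 2) / s))))
      (𝓝[>] 0) (𝓝 (w 0 * ∫ u in Ioi (0 : ℝ), p u)) := by
  have hφ := continuous_phi
  set L : ℝ := |c| + 1 with hL
  have hL1 : 1 ≤ L := by linarith [abs_nonneg c]
  have key := tendsto_integral_filter_of_dominated_convergence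
    (μ := volume.restrict (Ioi (0 : ℝ))) (l := 𝓝[>] (0 : ℝ))
    (F := fun s u => w (s * u) * (Real.exp (c * (s * u)) *
      phi ((x + s * u + d * s ^ 2) / s)))
    (f := fun u => w 0 * p u)
    (fun u => B * Real.exp (L ^ 2 / 2 + L * |d|) * Real.exp (-1 * u)) ?_ ?_
    ((integrableOn_exp_mul_Ioi (by norm_num) 0).const_mul _) ?_
  · rw [integral_const_mul] at key
    refine key.congr' ?_
    filter_upwards [self_mem_nhdsWithin] with s hs
    have hs0 : 0 < s := hs
    have := integral_comp_mul_left_Ioi (fun y => w y * (Real.exp (c * y) *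
      phi ((x + y + d * s ^ 2) / s))) 0 hs0
    rw [this, mul_zero, smul_eq_mul, ← integral_const_mul]
    refine integral_congr_ae (ae_of_all _ fun y => ?_)
    simp only [one_div]
    ring
  · filter_upwards [self_mem_nhdsWithin] with s hs
    have hs0 : 0 < s := hs
    refine AEStronglyMeasurable.mul ?_ (by fun_prop : Continuous _).aestronglyMeasurable
    refine ContinuousOn.aestronglyMeasurable ?_ measurableSet_Ioi
    exact hw.comp (by fun_prop) fun u hu => mem_Ici.mpr (mul_pos hs0 hu).le
  · filter_upwards [Ioo_mem_nhdsGT one_pos] with s ⟨hs0, hs1⟩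
    filter_upwards [ae_restrict_mem measurableSet_Ioi] with u hu
    have hu0 : 0 < u := hu
    have hsu : 0 < s * u := mul_pos hs0 hu0
    have hB0 : 0 ≤ B := (abs_nonneg _).trans (hB u hu)
    have harg : u - |d| ≤ (x + s * u + d * s ^ 2) / s := by
      rw [le_div_iff₀ hs0]
      nlinarith [abs_nonneg d, mul_nonneg (mul_nonneg hs0.le hs0.le)
        (by linarith [neg_abs_le d] : 0 ≤ d + |d|),
        mul_nonneg (abs_nonneg d) (mul_nonneg hs0.le (sub_nonneg.mpr hs1.le))]
    have hφle : phi ((x + s * u + d * s ^ 2) / s) ≤ Real.exp (L ^ 2 / 2 - L * (u - |d|)) := by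
      refine (phi_le_exp L _).trans ?_
      gcongr
    have hce : c * (s * u) ≤ |c| * u :=
      calc c * (s * u) ≤ |c| * (s * u) := by
            gcongr
            exact le_abs_self c
        _ ≤ |c| * u := by
            gcongr
            exact mul_le_of_le_one_left hu0.le hs1.le
    rw [Real.norm_eq_abs, abs_mul, abs_mul, Real.abs_exp, abs_of_nonneg (phi_nonneg _)]
    calc |w (s * u)| * (Real.exp (c * (s * u)) * phi ((x + s * u + d * s ^ 2) / s))
        ≤ B * (Real.exp (|c| * u) * Real.exp (L ^ 2 / 2 - L * (u - |d|))) := by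
          have := phi_nonneg ((x + s * u + d * s ^ 2) / s)
          gcongr
          exact hB _ hsu
      _ = _ := by
          rw [mul_assoc B, ← Real.exp_add, ← Real.exp_add, hL]
          ring_nf
  · filter_upwards [ae_restrict_mem measurableSet_Ioi] with u hu
    have hmul : Tendsto (fun s : ℝ => s * u) (𝓝[>] 0) (𝓝[≥] 0) :=
      tendsto_nhdsWithin_of_tendsto_nhds_of_eventually_within _
        (((continuous_mul_const u).tendsto' 0 0 (zero_mul u)).mono_left nhdsWithin_le_nhds)
        (eventually_mem_nhdsWithin.mono fun s hs => mem_Ici.mpr (mul_pos hs hu).le)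
    have h1 : Tendsto (fun s => w (s * u)) (𝓝[>] 0) (𝓝 (w 0)) :=
      (hw 0 self_mem_Ici).tendsto.comp hmul
    have h2 : Tendsto (fun s => Real.exp (c * (s * u))) (𝓝[>] 0) (𝓝 1) := by
      refine (Continuous.tendsto' ?_ 0 1 (by simp)).mono_left nhdsWithin_le_nhds
      fun_prop
    simpa using h1.mul (h2.mul (hp u hu))

/-- The spatial derivative of `∫ w(y) H(t;x,y) dy` tends to `-2 w(0) ∫ p`, where `p` is the
pointwise limit of the rescaled normal density. -/
theorem tendsto_derivWithin_integral_Hker {w p : ℝ → ℝ} {B x : ℝ} (μ ν : ℝ)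
    (hw : ContinuousOn w (Ici 0)) (hB : ∀ y ∈ Ioi (0 : ℝ), |w y| ≤ B) (hx : 0 ≤ x)
    (hp : ∀ u ∈ Ioi (0 : ℝ),
      Tendsto (fun s => phi ((x + s * u + μ * s ^ 2) / s)) (𝓝[>] 0) (𝓝 (p u))) :
    Tendsto (fun t => derivWithin (fun x => ∫ y in Ioi (0 : ℝ), w y * Hker μ ν t x y) (Ici 0) x)
      (𝓝[>] 0) (𝓝 (-2 * (w 0 * ∫ u in Ioi (0 : ℝ), p u))) := by
  have hwm : AEStronglyMeasurable w (volume.restrict (Ioi 0)) :=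
    (hw.mono Ioi_subset_Ici_self).aestronglyMeasurable measurableSet_Ioi
  have hA := (tendsto_integral_weight_mul_exp_mul_Psi (2 * (ν - μ)) (2 * μ) ν (2 * ν - μ)
    hwm hB hx).const_mul (2 * (2 * ν - μ))
  have hC := ((tendsto_integral_weight_mul_exp_mul_phi (2 * μ) μ hw hB hx hp).comp
    tendsto_sqrt_nhdsGT_zero).const_mul (-2)
  have hsum := hA.add hC
  rw [mul_zero, zero_add] at hsum
  refine hsum.congr' ?_
  filter_upwards [self_mem_nhdsWithin] with t ht
  have ht0 : 0 < t := ht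
  have hs := Real.sqrt_pos.mpr ht0
  simp_rw [Hker_eq_exp_mul_Hprofile]
  rw [(hasDerivAt_integral_weight_mul (2 * μ) x hwm hB (superexpDecay_Hprofile μ ν ht0)
    (superexpDecay_HprofileDeriv μ ν ht0) (continuous_HprofileDeriv μ ν t)
    fun z => hasDerivAt_Hprofile μ ν z ht0).hasDerivWithinAt.derivWithin
      (uniqueDiffOn_Ici 0 x hx)]
  simp only [Function.comp_apply, Real.sq_sqrt ht0.le]
  rw [← integral_const_mul, ← integral_const_mul, ← integral_add]
  · refine integral_congr_ae (ae_of_all _ fun y => ?_)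
    simp only [HprofileDeriv]
    ring
  · refine (integrableOn_weight_mul (2 * μ) x hwm hB
      (superexpDecay_exp_mul_Psi (2 * (ν - μ)) (ν * t) ((2 * ν - μ) * t) hs) ?_).const_mul _
    have := continuous_Psi
    fun_prop
  · refine (integrableOn_weight_mul (2 * μ) x hwm hB
      ((SuperexpDecay.phi_affine hs (μ * t)).const_mul (1 / Real.sqrt t)) ?_).const_mul _
    have := continuous_phi
    fun_prop

/-- behaviour of the spatial derivative of `u²` as `t ↓ 0`. -/
theorem u2_derivative_initial_limits (μ ν : ℝ) (f : ℝ → ℝ) (hf : IsInitialData f) :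
    (∀ x > (0 : ℝ),
      Filter.Tendsto
        (fun t => derivWithin
          (fun x' => ∫ y in Set.Ioi (0 : ℝ),
            derivWithin f (Set.Ici 0) y * Hker μ ν t x' y) (Set.Ici 0) x)
        (nhdsWithin 0 (Set.Ioi 0)) (nhds 0)) ∧
    Filter.Tendsto
      (fun t => derivWithin
        (fun x' => ∫ y in Set.Ioi (0 : ℝ),
          derivWithin f (Set.Ici 0) y * Hker μ ν t x' y) (Set.Ici 0) 0)
      (nhdsWithin 0 (Set.Ioi 0)) (nhds (-(derivWithin f (Set.Ici 0) 0))) := by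
  obtain ⟨hf1, ⟨C, hC⟩, -⟩ := hf
  have hw : ContinuousOn (derivWithin f (Ici 0)) (Ici 0) :=
    hf1.continuousOn_derivWithin (uniqueDiffOn_Ici 0) le_rfl
  have hB : ∀ y ∈ Ioi (0 : ℝ), |derivWithin f (Ici 0) y| ≤ C :=
    fun y hy => (hC y (mem_Ioi.mp hy).le).2
  constructor
  · intro x hx
    have h := tendsto_derivWithin_integral_Hker (p := fun _ => 0) μ ν hw hB hx.le fun u hu => ?_
    · simpa using h
    · have hlim := (tendsto_phi_atTop.comp
        (tendsto_atTop_add_const_right _ u (tendsto_add_mul_sq_div_atTop hx μ)))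
      refine hlim.congr' ?_
      filter_upwards [self_mem_nhdsWithin] with s hs
      have hs0 : s ≠ 0 := (mem_Ioi.mp hs).ne'
      simp only [Function.comp_apply]
      congr 1
      field_simp
      ring
  · have h := tendsto_derivWithin_integral_Hker (p := phi) μ ν hw hB le_rfl fun u hu => ?_
    · rw [integral_phi_Ioi_zero] at h
      convert h using 2
      ring
    · have hlim : Tendsto (fun s => phi (u + μ * s)) (𝓝[>] 0) (𝓝 (phi u)) := by
        have := continuous_phi
        refine (Continuous.tendsto' ?_ 0 _ (by simp)).mono_left nhdsWithin_le_nhds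
        fun_prop
      refine hlim.congr' ?_
      filter_upwards [self_mem_nhdsWithin] with s hs
      have hs0 : s ≠ 0 := (mem_Ioi.mp hs).ne'
      congr 1
      field_simp
      ring
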